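/- arXiv:2305.07391 — 9 statements merged into one kernel-verified Lean document; each statement's English description precedes it below -/
import Mathlib

section
/- Let n ≥ 1 and let A ∈ 𝔰𝔲(n+2). Then tr(A²B) = 0 for every B ∈ 𝔰𝔲(n+2) if and only if A² = (tr(A²)/(n+2))·1. In other words, the zero locus of the basic invariant cubic form of 𝔰𝔲(n+2) (the set of A such that the cubic form vanishes on (A,A,B) for all B) is precisely the hyperquadric 𝒞(n). -/
open Matrix

/-- The zero locus of the basic invariant cubic form of `𝔰𝔲(n+2)` is the hyperquadric
`𝒞(n)`: for `A ∈ 𝔰𝔲(n+2)`, one has `tr(A²B) = 0` for all `B ∈ 𝔰𝔲(n+2)` if and only if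
`A² = (tr(A²)/(n+2)) • 1`. -/
theorem su_cubic_zero_locus_eq_hyperquadric {n : ℕ} (hn : 1 ≤ n)
    (A : Matrix (Fin (n + 2)) (Fin (n + 2)) ℂ)
    (hA : Aᴴ = -A) (htrA : Matrix.trace A = 0) :
    (∀ B : Matrix (Fin (n + 2)) (Fin (n + 2)) ℂ, Bᴴ = -B → Matrix.trace B = 0 →
        Matrix.trace (A ^ 2 * B) = 0) ↔
      A ^ 2 = (Matrix.trace (A ^ 2) / ((n : ℂ) + 2)) •
        (1 : Matrix (Fin (n + 2)) (Fin (n + 2)) ℂ) := by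
  set c : ℂ := Matrix.trace (A ^ 2) / ((n : ℂ) + 2) with hc
  have hn0 : (n : ℂ) + 2 ≠ 0 := by exact_mod_cast Nat.succ_ne_zero (n + 1)
  have hA2 : (A ^ 2)ᴴ = A ^ 2 := by rw [conjTranspose_pow, hA, neg_sq]
  have hcstar : star c = c := by
    rw [hc, star_div₀, ← trace_conjTranspose, hA2]
    simp
  constructor
  · intro h
    set H := A ^ 2 - c • (1 : Matrix (Fin (n + 2)) (Fin (n + 2)) ℂ) with hH
    have hHherm : Hᴴ = H := by
      rw [hH, conjTranspose_sub, hA2, conjTranspose_smul, hcstar, conjTranspose_one]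
    have hHtr : trace H = 0 := by
      rw [hH, trace_sub, trace_smul, trace_one, Fintype.card_fin, smul_eq_mul, hc]
      push_cast
      rw [div_mul_cancel₀ _ hn0, sub_self]
    have htr : trace (A ^ 2 * (Complex.I • H)) = 0 :=
      h _ (by simp [conjTranspose_smul, hHherm]) (by rw [trace_smul, hHtr, smul_zero])
    have hA2H : A ^ 2 = H + c • 1 := by rw [hH, sub_add_cancel]
    have hHH : trace (Hᴴ * H) = 0 := by
      rw [hA2H, mul_smul_comm, trace_smul, add_mul, trace_add, smul_mul_assoc, one_mul,
        trace_smul, hHtr, smul_zero, add_zero, smul_eq_zero] at htr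
      rw [hHherm]
      exact htr.resolve_left Complex.I_ne_zero
    have hH0 : H = 0 := by
      open scoped ComplexOrder in exact trace_conjTranspose_mul_self_eq_zero_iff.mp hHH
    rw [hA2H, hH0, zero_add]
  · intro h B _ hB
    rw [h, smul_mul_assoc, one_mul, trace_smul, hB, smul_zero]
end

section
/- If n is odd, then the hyperquadric 𝒞(n) is trivial: the only A ∈ 𝔰𝔲(n+2) satisfying A² = (tr(A²)/(n+2))·1 is A = 0. -/
open Matrix

/-- The trace of an idempotent matrix over a field is a natural number, namely its rank. -/
theorem Matrix.exists_nat_trace_eq_of_isIdempotentElem {ι K : Type*} [Fintype ι] [DecidableEq ι]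
    [Field K] {P : Matrix ι ι K} (hP : IsIdempotentElem P) : ∃ k : ℕ, P.trace = k := by
  have hidem : IsIdempotentElem (Matrix.toLin' P) := by
    rw [IsIdempotentElem, Module.End.mul_eq_comp, ← Matrix.toLin'_mul, hP.eq]
  have h := (LinearMap.IsIdempotentElem.isProj_range _ hidem).trace
  rw [Matrix.trace_toLin'_eq] at h
  exact ⟨_, h⟩

/-- If a traceless matrix of odd size in characteristic zero squares to `s ^ 2 • 1`, then `s = 0`. -/
theorem Matrix.scalar_eq_zero_of_sq_eq_sq_smul_one {ι K : Type*} [Fintype ι]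
    [DecidableEq ι] [Field K] [CharZero K] (hodd : Odd (Fintype.card ι)) {A : Matrix ι ι K}
    (htr : A.trace = 0) {s : K} (hs : A ^ 2 = s ^ 2 • (1 : Matrix ι ι K)) : s = 0 := by
  by_contra hs0
  have hP : IsIdempotentElem ((2 : K)⁻¹ • (1 + s⁻¹ • A)) := by
    have hB : (s⁻¹ • A) * (s⁻¹ • A) = 1 := by
      rw [← sq, smul_pow, hs, smul_smul, ← mul_pow, inv_mul_cancel₀ hs0, one_pow, one_smul]
    rw [IsIdempotentElem, smul_mul_smul_comm, add_mul, mul_add, mul_add, hB]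
    simp only [one_mul, mul_one]
    module
  obtain ⟨k, hk⟩ := Matrix.exists_nat_trace_eq_of_isIdempotentElem hP
  rw [trace_smul, trace_add, trace_smul, htr, trace_one, smul_zero, add_zero, smul_eq_mul,
    inv_mul_eq_iff_eq_mul₀ two_ne_zero] at hk
  have hcard : Fintype.card ι = 2 * k := by exact_mod_cast hk
  rw [hcard] at hodd
  exact Nat.not_odd_iff_even.mpr (even_two_mul k) hodd

/-- For `n` odd the hyperquadric `𝒞(n) ⊆ 𝔰𝔲(n+2)` is trivial: the only
`A ∈ 𝔰𝔲(n+2)` with `A² = (tr(A²)/(n+2)) • 1` is `A = 0`. -/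
theorem hyperquadric_trivial_of_odd {n : ℕ} (hn : Odd n)
    (A : Matrix (Fin (n + 2)) (Fin (n + 2)) ℂ)
    (hA : Aᴴ = -A) (htrA : Matrix.trace A = 0)
    (hq : A ^ 2 = (Matrix.trace (A ^ 2) / ((n : ℂ) + 2)) •
        (1 : Matrix (Fin (n + 2)) (Fin (n + 2)) ℂ)) :
    A = 0 := by
  obtain ⟨s, hs⟩ := IsAlgClosed.exists_pow_nat_eq (Matrix.trace (A ^ 2) / ((n : ℂ) + 2)) two_pos
  rw [← hs] at hq
  have hodd : Odd (Fintype.card (Fin (n + 2))) := by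
    rw [Fintype.card_fin]
    exact hn.add_even even_two
  have hs0 := Matrix.scalar_eq_zero_of_sq_eq_sq_smul_one hodd htrA hq
  open scoped ComplexOrder in
  rw [← Matrix.conjTranspose_mul_self_eq_zero, hA, neg_mul, ← sq, hq, hs0]
  simp
end

section
/- Let V be a finite-dimensional real inner product space with orthonormal basis (e_k) and let J be an orthogonal complex structure on V (J² = −id and ⟨Jx,Jy⟩ = ⟨x,y⟩). Let F be a skew-adjoint endomorphism of V with tr(F∘J) = 0 (i.e. the 2-form F̂ is primitive). Then the contraction of F̂∧F̂ with the Kähler form equals twice the 2-form of F∘J∘F: for all x, y ∈ V, (1/2)·Σ_k (F̂∧F̂)(e_k, Je_k, x, y) = 2·⟨F(J(F(x))), y⟩. -/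
open scoped RealInnerProductSpace
/-- The wedge product of two `2`-forms, as a `4`-form (given by the explicit 6-term
formula). -/
def wedge2 {V : Type*} (α β : V → V → ℝ) : V → V → V → V → ℝ :=
  fun x y z w =>
    α x y * β z w - α x z * β y w + α x w * β y z +
      α y z * β x w - α y w * β x z + α z w * β x y

/-- Pointwise version of Lemma 5.2: for a primitive `J`-invariantly traced skew-adjoint
`F`, the contraction of `F̂ ∧ F̂` with the Kähler form equals `2 (F∘J∘F)^`. -/
theorem contraction_wedge_self_eq_two_FJF
    {V : Type*} [NormedAddCommGroup V] [InnerProductSpace ℝ V] [FiniteDimensional ℝ V]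
    {n : ℕ} (e : OrthonormalBasis (Fin n) ℝ V)
    (J : V →ₗ[ℝ] V) (hJ2 : ∀ x : V, J (J x) = -x)
    (hJorth : ∀ x y : V, ⟪J x, J y⟫ = ⟪x, y⟫)
    (F : V →ₗ[ℝ] V) (hFskew : ∀ x y : V, ⟪F x, y⟫ = -⟪x, F y⟫)
    (hFprim : LinearMap.trace ℝ V (F ∘ₗ J) = 0) :
    ∀ x y : V,
      (1 / 2 : ℝ) * ∑ k, wedge2 (fun a b => ⟪F a, b⟫) (fun a b => ⟪F a, b⟫)
          (e k) (J (e k)) x y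
        = 2 * ⟪F (J (F x)), y⟫ := by
  intro x y
  have hJskew : ∀ a b : V, ⟪J a, b⟫ = -⟪a, J b⟫ := fun a b => by
    rw [← hJorth a (J b), hJ2, inner_neg_right, neg_neg]
  have hF : ∀ k z, ⟪F (e k), z⟫ = -⟪F z, e k⟫ := fun k z => by
    rw [hFskew, real_inner_comm]
  have hFJ : ∀ k z, ⟪F (J (e k)), z⟫ = ⟪e k, J (F z)⟫ := fun k z => by
    rw [hFskew, hJskew, neg_neg]
  have htrace : ∑ k, ⟪F (e k), J (e k)⟫ = 0 := by
    rw [LinearMap.trace_eq_sum_inner _ e] at hFprim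
    simpa [hFskew] using hFprim
  have hterm : ∀ k, wedge2 (fun a b => ⟪F a, b⟫) (fun a b => ⟪F a, b⟫) (e k) (J (e k)) x y
      = 2 * ⟪F x, y⟫ * ⟪F (e k), J (e k)⟫ + 2 * (⟪F x, e k⟫ * ⟪e k, J (F y)⟫)
        - 2 * (⟪F y, e k⟫ * ⟪e k, J (F x)⟫) := fun k => by
    simp only [wedge2]
    rw [hF k x, hF k y, hFJ k x, hFJ k y]
    ring
  have hxy : ⟪F x, J (F y)⟫ = ⟪F (J (F x)), y⟫ := by
    rw [hFskew (J (F x)), hJskew, neg_neg]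
  have hyx : ⟪F y, J (F x)⟫ = -⟪F (J (F x)), y⟫ := by
    rw [hFskew (J (F x)), neg_neg, real_inner_comm]
  simp only [hterm, Finset.sum_add_distrib, Finset.sum_sub_distrib, ← Finset.mul_sum,
    e.sum_inner_mul_inner, htrace, hxy, hyx]
  ring
end

section
/- Let V be a real inner product space of dimension 2m with orthonormal basis (e_k), let I₁, I₂, I₃ be orthogonal complex structures with I₁I₂ = I₃ = −I₂I₁, let J be a further orthogonal complex structure on V commuting with each Iₐ, and set Ω̃ = ω_J∧ω_J + ((m−1)/3)·Ω. Then Ω̃ is primitive with respect to ω_J: Σ_k Ω̃(e_k, Je_k, x, y) = 0 for all x, y ∈ V. -/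
open scoped RealInnerProductSpace

/-- The Kraines `4`-form `Ω = Σₐ ωₐ ∧ ωₐ` of a quaternionic triple. -/
noncomputable def kraines {V : Type*} [NormedAddCommGroup V] [InnerProductSpace ℝ V]
    (I : Fin 3 → V →ₗ[ℝ] V) : V → V → V → V → ℝ :=
  fun x y z w =>
    ∑ a : Fin 3, wedge2 (fun p q => ⟪I a p, q⟫) (fun p q => ⟪I a p, q⟫) x y z w

section

variable {V : Type*} [NormedAddCommGroup V] [InnerProductSpace ℝ V]

/-- An orthogonal complex structure is skew-adjoint. -/
theorem inner_apply_left_of_orthogonal_complex {A : V →ₗ[ℝ] V} (hA2 : ∀ x, A (A x) = -x)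
    (hA : ∀ x y, ⟪A x, A y⟫ = ⟪x, y⟫) (x y : V) : ⟪A x, y⟫ = -⟪x, A y⟫ := by
  rw [← hA x (A y), hA2, inner_neg_right, neg_neg]

/-- The trace pairing `Σₖ ⟪A eₖ, J eₖ⟫` vanishes if some complex structure `B` commutes with `J`
and anticommutes with `A`. -/
theorem sum_inner_apply_apply_eq_zero {ι : Type*} [Fintype ι] (e : OrthonormalBasis ι ℝ V)
    {A B J : V →ₗ[ℝ] V} (hB2 : ∀ x, B (B x) = -x) (hAB : ∀ x, A (B x) = -B (A x))
    (hJB : ∀ x, J (B x) = B (J x)) (hJ2 : ∀ x, J (J x) = -x)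
    (hJ : ∀ x y, ⟪J x, J y⟫ = ⟪x, y⟫) : ∑ k, ⟪A (e k), J (e k)⟫ = 0 := by
  have htrace : ∑ k, ⟪A (e k), J (e k)⟫ = -LinearMap.trace ℝ V (J * A) := by
    rw [LinearMap.trace_eq_sum_inner _ e, ← Finset.sum_neg_distrib]
    refine Finset.sum_congr rfl fun k _ => ?_
    rw [Module.End.mul_apply, real_inner_comm (J (A (e k))),
      inner_apply_left_of_orthogonal_complex hJ2 hJ, neg_neg]
  have hconj : B * (J * A * B) = J * A := by
    ext x
    simp [hAB, hJB, hB2]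
  have hsq : J * A * B * B = -(J * A) := by
    ext x
    simp [hB2]
  have hcomm := LinearMap.trace_mul_comm ℝ B (J * A * B)
  rw [hconj, hsq, map_neg] at hcomm
  rw [htrace]
  linarith

/-- Contraction of `ω_A ∧ ω_A` with `ω_J` for commuting orthogonal complex structures. -/
theorem sum_wedge2_self_apply {ι : Type*} [Fintype ι] (e : OrthonormalBasis ι ℝ V)
    {A J : V →ₗ[ℝ] V} (hA2 : ∀ x, A (A x) = -x) (hA : ∀ x y, ⟪A x, A y⟫ = ⟪x, y⟫)
    (hJ2 : ∀ x, J (J x) = -x) (hJ : ∀ x y, ⟪J x, J y⟫ = ⟪x, y⟫)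
    (hJA : ∀ x, J (A x) = A (J x)) (x y : V) :
    ∑ k, wedge2 (fun p q => ⟪A p, q⟫) (fun p q => ⟪A p, q⟫) (e k) (J (e k)) x y =
      2 * (∑ k, ⟪A (e k), J (e k)⟫) * ⟪A x, y⟫ - 4 * ⟪J x, y⟫ := by
  have hcontract (u v : V) : ∑ k, ⟪A (e k), u⟫ * ⟪A (J (e k)), v⟫ = ⟪J u, v⟫ := by
    have hterm (k : ι) :
        ⟪A (e k), u⟫ * ⟪A (J (e k)), v⟫ = -(⟪A u, e k⟫ * ⟪e k, A (J v)⟫) := by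
      rw [inner_apply_left_of_orthogonal_complex hA2 hA (e k),
        inner_apply_left_of_orthogonal_complex hA2 hA (J (e k)),
        inner_apply_left_of_orthogonal_complex hJ2 hJ, hJA, real_inner_comm (A u)]
      ring
    simp_rw [hterm]
    rw [Finset.sum_neg_distrib, e.sum_inner_mul_inner, hA,
      inner_apply_left_of_orthogonal_complex hJ2 hJ]
  have hswap : ⟪J y, x⟫ = -⟪J x, y⟫ := by
    rw [inner_apply_left_of_orthogonal_complex hJ2 hJ, real_inner_comm]
  calc
    _ = ∑ k, (2 * (⟪A (e k), J (e k)⟫ * ⟪A x, y⟫) -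
          2 * (⟪A (e k), x⟫ * ⟪A (J (e k)), y⟫) +
          2 * (⟪A (e k), y⟫ * ⟪A (J (e k)), x⟫)) :=
      Finset.sum_congr rfl fun k _ => by simp only [wedge2]; ring
    _ = _ := by
      rw [Finset.sum_add_distrib, Finset.sum_sub_distrib, ← Finset.mul_sum, ← Finset.mul_sum,
        ← Finset.mul_sum, ← Finset.sum_mul, hcontract, hcontract, hswap]
      ring

end

/-- Pointwise primitivity part of Lemma 4.1: the `4`-form
`Ω̃ = ω_J ∧ ω_J + ((m-1)/3) Ω` is primitive with respect to `ω_J`. -/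
theorem tildeOmega_primitive
    {V : Type*} [NormedAddCommGroup V] [InnerProductSpace ℝ V] [FiniteDimensional ℝ V]
    {m : ℕ} (e : OrthonormalBasis (Fin (2 * m)) ℝ V)
    (I : Fin 3 → V →ₗ[ℝ] V)
    (hI2 : ∀ a, ∀ x : V, I a (I a x) = -x)
    (hIorth : ∀ a, ∀ x y : V, ⟪I a x, I a y⟫ = ⟪x, y⟫)
    (h12 : ∀ x : V, I 0 (I 1 x) = I 2 x)
    (h21 : ∀ x : V, I 1 (I 0 x) = -(I 2 x))
    (J : V →ₗ[ℝ] V) (hJ2 : ∀ x : V, J (J x) = -x)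
    (hJorth : ∀ x y : V, ⟪J x, J y⟫ = ⟪x, y⟫)
    (hJI : ∀ a, ∀ x : V, J (I a x) = I a (J x)) :
    ∀ x y : V,
      ∑ k, (wedge2 (fun p q => ⟪J p, q⟫) (fun p q => ⟪J p, q⟫) (e k) (J (e k)) x y +
        ((m : ℝ) - 1) / 3 * kraines I (e k) (J (e k)) x y) = 0 := by
  intro x y
  have hzero (a : Fin 3) : ∑ k, ⟪I a (e k), J (e k)⟫ = 0 := by
    have hexists : ∃ b, ∀ v, I a (I b v) = -I b (I a v) := by
      fin_cases a
      · exact ⟨1, fun v => by simp [h12, h21]⟩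
      · exact ⟨0, fun v => by simp [h12, h21]⟩
      · exact ⟨0, fun v => by simp [← h12, h21, hI2]⟩
    obtain ⟨b, hb⟩ := hexists
    exact sum_inner_apply_apply_eq_zero e (hI2 b) hb (hJI b) hJ2 hJorth
  have hdim : ∑ k, ⟪J (e k), J (e k)⟫ = 2 * (m : ℝ) := by
    simp_rw [hJorth]
    simp
  simp only [kraines]
  rw [Finset.sum_add_distrib, ← Finset.mul_sum, Finset.sum_comm,
    sum_wedge2_self_apply e hJ2 hJorth hJ2 hJorth (fun _ => rfl), hdim]
  have hkraines (a : Fin 3) :=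
    sum_wedge2_self_apply e (hI2 a) (hIorth a) hJ2 hJorth (hJI a) x y
  simp_rw [hzero, mul_zero, zero_mul, zero_sub] at hkraines
  rw [Finset.sum_congr rfl fun a _ => hkraines a]
  simp only [Finset.sum_const, Finset.card_univ, Fintype.card_fin, nsmul_eq_mul]
  push_cast
  ring
end

section
/- Let V be a real inner product space of dimension 2m with orthonormal basis (e_i), let I₁, I₂, I₃ be orthogonal complex structures with I₁I₂ = I₃ = −I₂I₁, let J be a further orthogonal complex structure commuting with each Iₐ, and set Ω̃ = ω_J∧ω_J + ((m−1)/3)·Ω. Let F be a skew-adjoint endomorphism of V with F∘J = J∘F and tr(F∘J) = 0, and define F_Q = (1/m)·Σₐ ⟨F̂, ωₐ⟩·Iₐ and F_E = (1/4)·(F − (I₁FI₁ + I₂FI₂ + I₃FI₃)). Then for all x, y ∈ V: (1/4)·Σ_i Ω̃(e_i, F e_i, x, y) = ((m−4)/3)·⟨Fx, y⟩ + (m(m−1)/3)·⟨F_Q x, y⟩ − (4(m−1)/3)·⟨F_E x, y⟩. -/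
open scoped RealInnerProductSpace

/-- An orthogonal complex structure is skew-adjoint. -/
theorem inner_map_left_eq_neg_of_orthogonal_of_sq_eq_neg
    {V : Type*} [NormedAddCommGroup V] [InnerProductSpace ℝ V]
    {K : V →ₗ[ℝ] V} (hK2 : ∀ x : V, K (K x) = -x)
    (hKorth : ∀ x y : V, ⟪K x, K y⟫ = ⟪x, y⟫) (x y : V) :
    ⟪K x, y⟫ = -⟪x, K y⟫ := by
  rw [← hKorth x (K y), hK2, inner_neg_right, neg_neg]

/-- The contraction of `ω ∧ ω` with a skew-adjoint `F`, where `ω` is the `2`-form of a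
skew-adjoint `K`. -/
theorem sum_wedge2_self_contraction
    {V ι : Type*} [NormedAddCommGroup V] [InnerProductSpace ℝ V] [Fintype ι]
    (e : OrthonormalBasis ι ℝ V) {K F : V →ₗ[ℝ] V}
    (hK : ∀ x y : V, ⟪K x, y⟫ = -⟪x, K y⟫) (hF : ∀ x y : V, ⟪F x, y⟫ = -⟪x, F y⟫)
    (x y : V) :
    ∑ i, wedge2 (fun p q => ⟪K p, q⟫) (fun p q => ⟪K p, q⟫) (e i) (F (e i)) x y =
      2 * (∑ i, ⟪K (e i), F (e i)⟫) * ⟪K x, y⟫ + 4 * ⟪K (F (K x)), y⟫ := by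
  have hmixed (u v : V) : ∑ i, ⟪K (e i), u⟫ * ⟪K (F (e i)), v⟫ = -⟪K (F (K u)), v⟫ := by
    have hterm (i : ι) :
        ⟪K (e i), u⟫ * ⟪K (F (e i)), v⟫ = -(⟪K u, e i⟫ * ⟪e i, F (K v)⟫) := by
      rw [hK (e i) u, hK (F (e i)) v, hF (e i), real_inner_comm (e i) (K u)]
      ring
    simp_rw [hterm]
    rw [Finset.sum_neg_distrib, e.sum_inner_mul_inner, hK (F (K u)), hF (K u)]
    ring
  have hskew : ⟪K (F (K y)), x⟫ = -⟪K (F (K x)), y⟫ := by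
    rw [hK, hF, hK, real_inner_comm]
    ring
  have hexpand (i : ι) :
      wedge2 (fun p q => ⟪K p, q⟫) (fun p q => ⟪K p, q⟫) (e i) (F (e i)) x y =
        2 * ⟪K (e i), F (e i)⟫ * ⟪K x, y⟫ - 2 * (⟪K (e i), x⟫ * ⟪K (F (e i)), y⟫) +
          2 * (⟪K (e i), y⟫ * ⟪K (F (e i)), x⟫) := by
    simp only [wedge2]
    ring
  simp_rw [hexpand]
  rw [Finset.sum_add_distrib, Finset.sum_sub_distrib, ← Finset.sum_mul, ← Finset.mul_sum,
    ← Finset.mul_sum, ← Finset.mul_sum, hmixed, hmixed, hskew]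
  ring

/-- Lemma 5.4 (ii), stated pointwise: for a primitive `J`-commuting skew-adjoint `F`,
`½ L*_F Ω̃ = ((m-4)/3) F + (m(m-1)/3) F_Q - (4(m-1)/3) F_E`, where
`F_Q = (1/m) Σₐ ⟨F̂, ωₐ⟩ Iₐ` and `F_E = ¼ (F - Σₐ Iₐ F Iₐ)`. -/
theorem contraction_tildeOmega_with_F
    {V : Type*} [NormedAddCommGroup V] [InnerProductSpace ℝ V] [FiniteDimensional ℝ V]
    {m : ℕ} (e : OrthonormalBasis (Fin (2 * m)) ℝ V)
    (I : Fin 3 → V →ₗ[ℝ] V)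
    (hI2 : ∀ a, ∀ x : V, I a (I a x) = -x)
    (hIorth : ∀ a, ∀ x y : V, ⟪I a x, I a y⟫ = ⟪x, y⟫)
    (h12 : ∀ x : V, I 0 (I 1 x) = I 2 x)
    (h21 : ∀ x : V, I 1 (I 0 x) = -(I 2 x))
    (J : V →ₗ[ℝ] V) (hJ2 : ∀ x : V, J (J x) = -x)
    (hJorth : ∀ x y : V, ⟪J x, J y⟫ = ⟪x, y⟫)
    (hJI : ∀ a, ∀ x : V, J (I a x) = I a (J x))
    (F : V →ₗ[ℝ] V) (hFskew : ∀ x y : V, ⟪F x, y⟫ = -⟪x, F y⟫)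
    (hFJ : ∀ x : V, F (J x) = J (F x))
    (hFprim : LinearMap.trace ℝ V (F ∘ₗ J) = 0) :
    ∀ x y : V,
      (1 / 4 : ℝ) * ∑ i,
          (wedge2 (fun p q => ⟪J p, q⟫) (fun p q => ⟪J p, q⟫) (e i) (F (e i)) x y +
            ((m : ℝ) - 1) / 3 * kraines I (e i) (F (e i)) x y)
        = ((m : ℝ) - 4) / 3 * ⟪F x, y⟫ +
          (m : ℝ) * ((m : ℝ) - 1) / 3 *
            ((m : ℝ)⁻¹ * ∑ a : Fin 3,
              ((1 / 2 : ℝ) * ∑ i, ∑ j, ⟪F (e i), e j⟫ * ⟪I a (e i), e j⟫) * ⟪I a x, y⟫) -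
          4 * ((m : ℝ) - 1) / 3 *
            ((1 / 4 : ℝ) * (⟪F x, y⟫ - ∑ a : Fin 3, ⟪I a (F (I a x)), y⟫)) := by
  intro x y
  have hIskew a := inner_map_left_eq_neg_of_orthogonal_of_sq_eq_neg (hI2 a) (hIorth a)
  have hJskew := inner_map_left_eq_neg_of_orthogonal_of_sq_eq_neg hJ2 hJorth
  have hJtrace : ∑ i, ⟪J (e i), F (e i)⟫ = 0 := by
    rw [LinearMap.trace_eq_sum_inner _ e] at hFprim
    simpa [hJskew, hFJ] using hFprim
  have hJFJ : J (F (J x)) = -F x := by rw [hFJ, hJ2]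
  have hpair (a : Fin 3) : ∑ i, ∑ j, ⟪F (e i), e j⟫ * ⟪I a (e i), e j⟫ =
      ∑ i, ⟪I a (e i), F (e i)⟫ := by
    refine Finset.sum_congr rfl fun i _ => ?_
    rw [← e.sum_inner_mul_inner]
    refine Finset.sum_congr rfl fun j _ => ?_
    rw [real_inner_comm (F (e i)) (e j), mul_comm]
  have hkraines : ∑ i, kraines I (e i) (F (e i)) x y =
      ∑ a, (2 * (∑ i, ⟪I a (e i), F (e i)⟫) * ⟪I a x, y⟫ + 4 * ⟪I a (F (I a x)), y⟫) := by
    simp only [kraines]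
    rw [Finset.sum_comm]
    exact Finset.sum_congr rfl fun a _ => sum_wedge2_self_contraction e (hIskew a) hFskew x y
  rw [Finset.sum_add_distrib, ← Finset.mul_sum, hkraines,
    sum_wedge2_self_contraction e hJskew hFskew, hJtrace, hJFJ, inner_neg_left]
  simp_rw [hpair, Fin.sum_univ_three]
  rcases Nat.eq_zero_or_pos m with rfl | hm
  · have hx : x = 0 := by
      rw [← e.sum_repr x]
      simp
    simp [hx]
  · have hm' : (m : ℝ) ≠ 0 := by positivity
    field_simp
    ring
end

section
/- Let V be a real inner product space of dimension 2m with orthonormal basis (e_k), let I₁, I₂, I₃ be orthogonal complex structures with I₁I₂ = I₃ = −I₂I₁, and let Ω be the Kraines 4-form. Then the contraction of Ω with ω₁ equals 2(m+1)·ω₁: for all x, y ∈ V, (1/2)·Σ_k Ω(e_k, I₁e_k, x, y) = 2(m+1)·ω₁(x,y). -/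
open scoped RealInnerProductSpace

section

variable {V : Type*} [NormedAddCommGroup V] [InnerProductSpace ℝ V]

/-- An orthogonal complex structure is skew-adjoint. -/
theorem inner_complexStructure_left {J : V →ₗ[ℝ] V} (hJ : ∀ x, J (J x) = -x)
    (hJorth : ∀ x y : V, ⟪J x, J y⟫ = ⟪x, y⟫) (x y : V) : ⟪J x, y⟫ = -⟪x, J y⟫ := by
  rw [← hJorth x (J y), hJ, inner_neg_right, neg_neg]

/-- Summing `⟪J eₖ, x⟫ ⟪K eₖ, y⟫` over an orthonormal basis, for `J` and `K` skew-adjoint. -/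
theorem sum_inner_mul_inner_of_skew {ι : Type*} [Fintype ι] (e : OrthonormalBasis ι ℝ V)
    {J K : V → V} (hJ : ∀ x y : V, ⟪J x, y⟫ = -⟪x, J y⟫) (hK : ∀ x y : V, ⟪K x, y⟫ = -⟪x, K y⟫)
    (x y : V) : ∑ k, ⟪J (e k), x⟫ * ⟪K (e k), y⟫ = ⟪J x, K y⟫ := by
  rw [← e.sum_inner_mul_inner]
  refine Finset.sum_congr rfl fun k _ => ?_
  rw [hJ, hK, real_inner_comm (e k) (J x)]
  ring

/-- The contraction of `ω ∧ ω`, where `ω = ⟪J ·, ·⟫`, with a map `K`. -/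
theorem sum_wedge2_self {ι : Type*} [Fintype ι] (e : OrthonormalBasis ι ℝ V)
    (J K : V → V) (x y : V) :
    ∑ k, wedge2 (fun p q => ⟪J p, q⟫) (fun p q => ⟪J p, q⟫) (e k) (K (e k)) x y =
      2 * ((∑ k, ⟪J (e k), K (e k)⟫) * ⟪J x, y⟫ - ∑ k, ⟪J (e k), x⟫ * ⟪J (K (e k)), y⟫ +
        ∑ k, ⟪J (e k), y⟫ * ⟪J (K (e k)), x⟫) := by
  rw [Finset.sum_mul, ← Finset.sum_sub_distrib, ← Finset.sum_add_distrib, Finset.mul_sum]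
  refine Finset.sum_congr rfl fun k _ => ?_
  simp only [wedge2]
  ring

/-- If `J` and `K` are anticommuting orthogonal complex structures, then contracting `ω_J ∧ ω_J`
with `K` gives `4 ω_K`. -/
theorem sum_wedge2_self_of_anticommute {ι : Type*} [Fintype ι] (e : OrthonormalBasis ι ℝ V)
    {J K : V →ₗ[ℝ] V} (hJ : ∀ x, J (J x) = -x) (hJorth : ∀ x y : V, ⟪J x, J y⟫ = ⟪x, y⟫)
    (hK : ∀ x, K (K x) = -x) (hKorth : ∀ x y : V, ⟪K x, K y⟫ = ⟪x, y⟫)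
    (hJK : ∀ x, J (K x) = -K (J x)) (x y : V) :
    ∑ k, wedge2 (fun p q => ⟪J p, q⟫) (fun p q => ⟪J p, q⟫) (e k) (K (e k)) x y =
      4 * ⟪K x, y⟫ := by
  have sJ := inner_complexStructure_left hJ hJorth
  have sK := inner_complexStructure_left hK hKorth
  have sJK (u v : V) : ⟪J (K u), v⟫ = -⟪u, J (K v)⟫ := by
    rw [sJ, sK, hJK, inner_neg_right, neg_neg]
  have trace_zero (u : V) : ⟪J u, K u⟫ = 0 := by
    have h : ⟪u, J (K u)⟫ = -⟪u, J (K u)⟫ := by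
      rw [← sJK, real_inner_comm]
    rw [sJ]
    linarith
  have hsum (u v : V) : ∑ k, ⟪J (e k), u⟫ * ⟪J (K (e k)), v⟫ = -⟪K u, v⟫ := by
    rw [sum_inner_mul_inner_of_skew e sJ sJK, hJorth, sK, neg_neg]
  rw [sum_wedge2_self e J K, hsum, hsum]
  simp only [trace_zero, Finset.sum_const_zero]
  rw [sK y x, real_inner_comm (K x) y]
  ring

/-- Contracting `ω_J ∧ ω_J` with the orthogonal complex structure `J` itself gives
`2 (dim V - 2) ω_J`. -/
theorem sum_wedge2_self_same {ι : Type*} [Fintype ι] (e : OrthonormalBasis ι ℝ V)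
    {J : V →ₗ[ℝ] V} (hJ : ∀ x, J (J x) = -x) (hJorth : ∀ x y : V, ⟪J x, J y⟫ = ⟪x, y⟫)
    (x y : V) :
    ∑ k, wedge2 (fun p q => ⟪J p, q⟫) (fun p q => ⟪J p, q⟫) (e k) (J (e k)) x y =
      2 * ((Fintype.card ι : ℝ) - 2) * ⟪J x, y⟫ := by
  have sJ := inner_complexStructure_left hJ hJorth
  have hsum (u v : V) : ∑ k, ⟪J (e k), u⟫ * ⟪J (J (e k)), v⟫ = ⟪J u, v⟫ := by
    rw [← e.sum_inner_mul_inner]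
    refine Finset.sum_congr rfl fun k _ => ?_
    rw [hJ, sJ, inner_neg_left, real_inner_comm (e k) (J u)]
    ring
  have htrace : ∑ k, ⟪J (e k), J (e k)⟫ = (Fintype.card ι : ℝ) := by
    simp only [hJorth]
    simp
  rw [sum_wedge2_self e J J, hsum, hsum, htrace, sJ y x, real_inner_comm (J x) y]
  ring

end

/-- The identity `L*_{ω₁} Ω = 2(m+1) ω₁` from the proof of Lemma 4.1, stated
pointwise. -/
theorem contraction_kraines_with_omega_one
    {V : Type*} [NormedAddCommGroup V] [InnerProductSpace ℝ V] [FiniteDimensional ℝ V]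
    {m : ℕ} (e : OrthonormalBasis (Fin (2 * m)) ℝ V)
    (I : Fin 3 → V →ₗ[ℝ] V)
    (hI2 : ∀ a, ∀ x : V, I a (I a x) = -x)
    (hIorth : ∀ a, ∀ x y : V, ⟪I a x, I a y⟫ = ⟪x, y⟫)
    (h12 : ∀ x : V, I 0 (I 1 x) = I 2 x)
    (h21 : ∀ x : V, I 1 (I 0 x) = -(I 2 x)) :
    ∀ x y : V,
      (1 / 2 : ℝ) * ∑ k, kraines I (e k) (I 0 (e k)) x y
        = 2 * ((m : ℝ) + 1) * ⟪I 0 x, y⟫ := by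
  intro x y
  have anticomm₁ (v : V) : I 1 (I 0 v) = -I 0 (I 1 v) := by rw [h21, h12]
  have anticomm₂ (v : V) : I 2 (I 0 v) = -I 0 (I 2 v) := by
    rw [← h12, ← h12, hI2, neg_neg, h21, ← h12, map_neg, hI2, neg_neg]
  simp only [kraines]
  rw [Finset.sum_comm, Fin.sum_univ_three,
    sum_wedge2_self_same e (hI2 0) (hIorth 0),
    sum_wedge2_self_of_anticommute e (hI2 1) (hIorth 1) (hI2 0) (hIorth 0) anticomm₁,
    sum_wedge2_self_of_anticommute e (hI2 2) (hIorth 2) (hI2 0) (hIorth 0) anticomm₂,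
    Fintype.card_fin]
  push_cast
  ring
end

section
/- Let V be a real inner product space of dimension 2m with orthonormal basis (e_k), let I₁, I₂, I₃ be orthogonal complex structures with I₁I₂ = I₃ = −I₂I₁, and let Ω be the Kraines 4-form. Then for all symmetric (self-adjoint) traceless endomorphisms h₁, h₂ of V: ⟨ι_{h₁}Ω, ι_{h₂}Ω⟩ = −4(m+4)·tr(C(h₁)∘h₂) + 12m·tr(h₁∘h₂), where C(h) = I₁hI₁ + I₂hI₂ + I₃hI₃. -/
open scoped RealInnerProductSpace

/-- The operation `ι_h` on `4`-forms: `(ι_h γ)(x,y,z,w) = γ(hx,y,z,w) + γ(x,hy,z,w) +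
γ(x,y,hz,w) + γ(x,y,z,hw)`. -/
def iota4 {V : Type*} (h : V → V) (γ : V → V → V → V → ℝ) : V → V → V → V → ℝ :=
  fun x y z w => γ (h x) y z w + γ x (h y) z w + γ x y (h z) w + γ x y z (h w)

open Matrix

section QuadrupleSums

variable {ι : Type*} [Fintype ι]

lemma sum_four_swap_left (f : ι → ι → ι → ι → ℝ) :
    ∑ i, ∑ j, ∑ k, ∑ l, f j i k l = ∑ i, ∑ j, ∑ k, ∑ l, f i j k l :=
  Finset.sum_comm

lemma sum_four_swap_middle (f : ι → ι → ι → ι → ℝ) :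
    ∑ i, ∑ j, ∑ k, ∑ l, f i k j l = ∑ i, ∑ j, ∑ k, ∑ l, f i j k l :=
  Finset.sum_congr rfl fun _ _ => Finset.sum_comm

lemma sum_four_swap_right (f : ι → ι → ι → ι → ℝ) :
    ∑ i, ∑ j, ∑ k, ∑ l, f i j l k = ∑ i, ∑ j, ∑ k, ∑ l, f i j k l :=
  Finset.sum_congr rfl fun _ _ => Finset.sum_congr rfl fun _ _ => Finset.sum_comm

lemma sum_four_eq_neg_of_swap_left {f g : ι → ι → ι → ι → ℝ}
    (h : ∀ i j k l, f j i k l = -g i j k l) :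
    ∑ i, ∑ j, ∑ k, ∑ l, f i j k l = -∑ i, ∑ j, ∑ k, ∑ l, g i j k l := by
  rw [← sum_four_swap_left f]
  simp only [h, Finset.sum_neg_distrib]

lemma sum_four_eq_neg_of_swap_middle {f g : ι → ι → ι → ι → ℝ}
    (h : ∀ i j k l, f i k j l = -g i j k l) :
    ∑ i, ∑ j, ∑ k, ∑ l, f i j k l = -∑ i, ∑ j, ∑ k, ∑ l, g i j k l := by
  rw [← sum_four_swap_middle f]
  simp only [h, Finset.sum_neg_distrib]

lemma sum_four_eq_neg_of_swap_right {f g : ι → ι → ι → ι → ℝ}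
    (h : ∀ i j k l, f i j l k = -g i j k l) :
    ∑ i, ∑ j, ∑ k, ∑ l, f i j k l = -∑ i, ∑ j, ∑ k, ∑ l, g i j k l := by
  rw [← sum_four_swap_right f]
  simp only [h, Finset.sum_neg_distrib]

/-- Pairing a wedge product of 2-forms with an alternating 4-form. -/
lemma sum_wedge2_mul_of_alternating (A B : ι → ι → ℝ) (G : ι → ι → ι → ι → ℝ)
    (hl : ∀ i j k l, G j i k l = -G i j k l) (hm : ∀ i j k l, G i k j l = -G i j k l)
    (hr : ∀ i j k l, G i j l k = -G i j k l) :
    ∑ i, ∑ j, ∑ k, ∑ l, wedge2 A B i j k l * G i j k l =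
      6 * ∑ i, ∑ j, ∑ k, ∑ l, A i j * B k l * G i j k l := by
  have ikjl : ∑ i, ∑ j, ∑ k, ∑ l, A i k * B j l * G i j k l =
      -∑ i, ∑ j, ∑ k, ∑ l, A i j * B k l * G i j k l :=
    sum_four_eq_neg_of_swap_middle fun i j k l => by rw [hm]; ring
  have iljk : ∑ i, ∑ j, ∑ k, ∑ l, A i l * B j k * G i j k l =
      -∑ i, ∑ j, ∑ k, ∑ l, A i k * B j l * G i j k l :=
    sum_four_eq_neg_of_swap_right fun i j k l => by rw [hr]; ring
  have jkil : ∑ i, ∑ j, ∑ k, ∑ l, A j k * B i l * G i j k l =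
      -∑ i, ∑ j, ∑ k, ∑ l, A i k * B j l * G i j k l :=
    sum_four_eq_neg_of_swap_left fun i j k l => by rw [hl]; ring
  have jlik : ∑ i, ∑ j, ∑ k, ∑ l, A j l * B i k * G i j k l =
      -∑ i, ∑ j, ∑ k, ∑ l, A j k * B i l * G i j k l :=
    sum_four_eq_neg_of_swap_right fun i j k l => by rw [hr]; ring
  have klij : ∑ i, ∑ j, ∑ k, ∑ l, A k l * B i j * G i j k l =
      -∑ i, ∑ j, ∑ k, ∑ l, A j l * B i k * G i j k l :=
    sum_four_eq_neg_of_swap_middle fun i j k l => by rw [hm]; ring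
  have expand : ∀ i j k l, wedge2 A B i j k l * G i j k l =
      A i j * B k l * G i j k l - A i k * B j l * G i j k l + A i l * B j k * G i j k l +
        A j k * B i l * G i j k l - A j l * B i k * G i j k l + A k l * B i j * G i j k l := by
    intro i j k l
    simp only [wedge2]
    ring
  simp only [expand, Finset.sum_add_distrib, Finset.sum_sub_distrib]
  linarith

lemma trace_mul_mul_trace_mul_eq_sum {A B C D : Matrix ι ι ℝ} (hC : Cᵀ = -C) (hD : Dᵀ = -D) :
    (A * C).trace * (B * D).trace =
      ∑ i, ∑ j, ∑ k, ∑ l, A i j * B k l * (C i j * D k l) := by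
  have sC : ∀ i j, C j i = -C i j := fun i j => congrFun₂ hC i j
  have sD : ∀ i j, D j i = -D i j := fun i j => congrFun₂ hD i j
  simp only [Matrix.trace, Matrix.diag, Matrix.mul_apply, Finset.sum_mul]
  refine Finset.sum_congr rfl fun i _ => Finset.sum_congr rfl fun j _ => ?_
  simp only [Finset.mul_sum]
  refine Finset.sum_congr rfl fun k _ => Finset.sum_congr rfl fun l _ => ?_
  rw [sC i j, sD k l]
  ring

lemma trace_mul_mul_mul_eq_sum {A B C D : Matrix ι ι ℝ} (hA : Aᵀ = -A) (hD : Dᵀ = -D) :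
    (A * C * B * D).trace = ∑ i, ∑ j, ∑ k, ∑ l, A i j * B k l * (C i k * D j l) := by
  have sA : ∀ i j, A j i = -A i j := fun i j => congrFun₂ hA i j
  have sD : ∀ i j, D j i = -D i j := fun i j => congrFun₂ hD i j
  simp only [Matrix.trace, Matrix.diag, Matrix.mul_apply, Finset.sum_mul]
  rw [← sum_four_swap_right, ← sum_four_swap_middle, ← sum_four_swap_right, ← sum_four_swap_left]
  refine Finset.sum_congr rfl fun i _ => Finset.sum_congr rfl fun j _ =>
    Finset.sum_congr rfl fun k _ => Finset.sum_congr rfl fun l _ => ?_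
  rw [sA i j, sD j l]
  ring

/-- The inner product of two wedge products of 2-forms, in terms of their matrices. -/
lemma sum_wedge2_mul_wedge2 {A B C D : Matrix ι ι ℝ}
    (hA : Aᵀ = -A) (hB : Bᵀ = -B) (hC : Cᵀ = -C) (hD : Dᵀ = -D) :
    ∑ i, ∑ j, ∑ k, ∑ l, wedge2 A B i j k l * wedge2 C D i j k l =
      6 * ((A * C).trace * (B * D).trace + (A * D).trace * (B * C).trace -
        4 * (A * C * B * D).trace) := by
  have sA : ∀ i j, A j i = -A i j := fun i j => congrFun₂ hA i j
  have sB : ∀ i j, B j i = -B i j := fun i j => congrFun₂ hB i j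
  have sC : ∀ i j, C j i = -C i j := fun i j => congrFun₂ hC i j
  have sD : ∀ i j, D j i = -D i j := fun i j => congrFun₂ hD i j
  rw [sum_wedge2_mul_of_alternating A B (fun i j k l => wedge2 C D i j k l)
    (fun i j k l => by simp only [wedge2]; rw [sC i j, sD i j]; ring)
    (fun i j k l => by simp only [wedge2]; rw [sC j k, sD j k]; ring)
    (fun i j k l => by simp only [wedge2]; rw [sC k l, sD k l]; ring),
    trace_mul_mul_trace_mul_eq_sum hC hD, trace_mul_mul_trace_mul_eq_sum hD hC,
    trace_mul_mul_mul_eq_sum hA hD]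
  have iljk : ∑ i, ∑ j, ∑ k, ∑ l, A i j * B k l * (C i l * D j k) =
      -∑ i, ∑ j, ∑ k, ∑ l, A i j * B k l * (C i k * D j l) :=
    sum_four_eq_neg_of_swap_right fun i j k l => by rw [sB k l]; ring
  have jkil : ∑ i, ∑ j, ∑ k, ∑ l, A i j * B k l * (C j k * D i l) =
      -∑ i, ∑ j, ∑ k, ∑ l, A i j * B k l * (C i k * D j l) :=
    sum_four_eq_neg_of_swap_left fun i j k l => by rw [sA i j]; ring
  have jlik : ∑ i, ∑ j, ∑ k, ∑ l, A i j * B k l * (C j l * D i k) =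
      -∑ i, ∑ j, ∑ k, ∑ l, A i j * B k l * (C j k * D i l) :=
    sum_four_eq_neg_of_swap_right fun i j k l => by rw [sB k l]; ring
  have expand : ∀ i j k l, A i j * B k l * wedge2 C D i j k l =
      A i j * B k l * (C i j * D k l) - A i j * B k l * (C i k * D j l) +
        A i j * B k l * (C i l * D j k) + A i j * B k l * (C j k * D i l) -
        A i j * B k l * (C j l * D i k) + A i j * B k l * (D i j * C k l) := by
    intro i j k l
    simp only [wedge2]
    ring
  simp only [expand, Finset.sum_add_distrib, Finset.sum_sub_distrib]
  linarith

end QuadrupleSums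

section Traces

variable {ι : Type*} [Fintype ι] [DecidableEq ι]

lemma trace_anticomm_mul_anticomm {P H K : Matrix ι ι ℝ} (hP : P * P = -1) :
    ((P * H + H * P) * (P * K + K * P)).trace =
      2 * (P * H * P * K).trace - 2 * (H * K).trace := by
  have t₁ : (P * H * K * P).trace = -(H * K).trace := by
    rw [Matrix.trace_mul_comm, ← mul_assoc, ← mul_assoc, hP]
    simp
  have t₂ : (H * P * P * K).trace = -(H * K).trace := by
    rw [mul_assoc H, hP]
    simp
  have t₃ : (H * P * K * P).trace = (P * H * P * K).trace := by
    rw [Matrix.trace_mul_comm]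
    simp only [mul_assoc]
  simp only [mul_add, add_mul, ← mul_assoc, Matrix.trace_add, t₁, t₂, t₃]
  ring

lemma trace_anticomm_mul_left_eq_zero {P Q H : Matrix ι ι ℝ} (hPQ : P * Q = -(Q * P)) :
    ((P * H + H * P) * Q).trace = 0 := by
  have t : (P * H * Q).trace = -(H * P * Q).trace := by
    rw [Matrix.trace_mul_comm, ← mul_assoc, Matrix.trace_mul_comm, mul_assoc H, hPQ]
    simp
  rw [add_mul, Matrix.trace_add, t, neg_add_cancel]

lemma trace_anticomm_mul_self {P H : Matrix ι ι ℝ} (hP : P * P = -1) :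
    ((P * H + H * P) * P).trace = -2 * H.trace := by
  have t : (P * H * P).trace = -H.trace := by
    rw [Matrix.trace_mul_comm, ← mul_assoc, hP]
    simp
  rw [add_mul, Matrix.trace_add, t, mul_assoc H, hP]
  simp
  ring

lemma trace_anticomm_mul_anticomm_mul_mul {P Q H K : Matrix ι ι ℝ} (hP : P * P = -1)
    (hQ : Q * Q = -1) (hPQ : P * Q = -(Q * P)) :
    ((P * H + H * P) * (Q * K + K * Q) * P * Q).trace =
      (P * H * P * K).trace + (Q * H * Q * K).trace + (P * Q * H * (P * Q) * K).trace -
        (H * K).trace := by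
  have hQPQ : Q * P * Q = P := by
    rw [mul_assoc, hPQ, mul_neg, ← mul_assoc, hQ]
    simp
  have hPQP : P * Q * P = Q := by
    rw [hPQ, neg_mul, mul_assoc, hP]
    simp
  have t₁ : (P * H * Q * K * P * Q).trace = (Q * H * Q * K).trace := by
    rw [show P * H * Q * K * P * Q = P * (H * Q * K * P * Q) by simp only [mul_assoc],
      Matrix.trace_mul_comm,
      show H * Q * K * P * Q * P = H * Q * K * (P * Q * P) by simp only [mul_assoc], hPQP,
      Matrix.trace_mul_comm]
    simp only [mul_assoc]
  have t₂ : (P * H * K * Q * P * Q).trace = -(H * K).trace := by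
    rw [show P * H * K * Q * P * Q = P * H * K * (Q * P * Q) by simp only [mul_assoc], hQPQ,
      Matrix.trace_mul_comm, ← mul_assoc, ← mul_assoc, hP]
    simp
  have t₃ : (H * P * Q * K * P * Q).trace = (P * Q * H * (P * Q) * K).trace := by
    rw [show H * P * Q * K * P * Q = H * P * Q * K * (P * Q) by simp only [mul_assoc],
      Matrix.trace_mul_comm]
    simp only [mul_assoc]
  have t₄ : (H * P * K * Q * P * Q).trace = (P * H * P * K).trace := by
    rw [show H * P * K * Q * P * Q = H * P * K * (Q * P * Q) by simp only [mul_assoc], hQPQ,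
      Matrix.trace_mul_comm]
    simp only [mul_assoc]
  simp only [mul_add, add_mul, ← mul_assoc, Matrix.trace_add] at t₃ ⊢
  rw [t₁, t₂, t₃, t₄]
  ring

end Traces

section QuaternionicTriples

variable {ι : Type*} [Fintype ι]

lemma transpose_anticomm {P H : Matrix ι ι ℝ} (hP : Pᵀ = -P) (hH : Hᵀ = H) :
    (P * H + H * P)ᵀ = -(P * H + H * P) := by
  rw [Matrix.transpose_add, Matrix.transpose_mul, Matrix.transpose_mul, hP, hH, mul_neg, neg_mul]
  abel

variable [DecidableEq ι]

lemma sum_wedge2_anticomm_self {P H K : Matrix ι ι ℝ} (hP : P * P = -1) (hPt : Pᵀ = -P)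
    (hH : Hᵀ = H) (hK : Kᵀ = K) (hHtr : H.trace = 0) :
    ∑ i, ∑ j, ∑ k, ∑ l, wedge2 (P * H + H * P) P i j k l * wedge2 (P * K + K * P) P i j k l =
      12 * (4 - Fintype.card ι) * ((P * H * P * K).trace - (H * K).trace) := by
  rw [sum_wedge2_mul_wedge2 (transpose_anticomm hPt hH) hPt (transpose_anticomm hPt hK) hPt,
    mul_assoc _ P P, hP, trace_anticomm_mul_self hP, hHtr, mul_neg_one, Matrix.trace_neg,
    Matrix.trace_neg, Matrix.trace_one, trace_anticomm_mul_anticomm hP]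
  ring

lemma sum_wedge2_anticomm_of_anticommute {P Q H K : Matrix ι ι ℝ} (hP : P * P = -1)
    (hQ : Q * Q = -1) (hPQ : P * Q = -(Q * P)) (hPt : Pᵀ = -P) (hQt : Qᵀ = -Q)
    (hH : Hᵀ = H) (hK : Kᵀ = K) :
    ∑ i, ∑ j, ∑ k, ∑ l, wedge2 (P * H + H * P) P i j k l * wedge2 (Q * K + K * Q) Q i j k l =
      -24 * ((P * H * P * K).trace + (Q * H * Q * K).trace + (P * Q * H * (P * Q) * K).trace -
        (H * K).trace) := by
  have hPQtr : (P * Q).trace = 0 := by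
    have h := Matrix.trace_mul_comm P Q
    have h' := congrArg Matrix.trace hPQ
    rw [Matrix.trace_neg] at h'
    linarith
  rw [sum_wedge2_mul_wedge2 (transpose_anticomm hPt hH) hPt (transpose_anticomm hQt hK) hQt,
    hPQtr, trace_anticomm_mul_left_eq_zero hPQ, trace_anticomm_mul_anticomm_mul_mul hP hQ hPQ]
  ring

/-- The inner product of the derivatives of the Kraines form in terms of the matrices of a
quaternionic triple. -/
lemma sum_wedge2_anticomm_mul_sum_wedge2_anticomm {P : Fin 3 → Matrix ι ι ℝ} {H K : Matrix ι ι ℝ}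
    (hP : ∀ a, P a * P a = -1) (hPt : ∀ a, (P a)ᵀ = -P a) (h01 : P 0 * P 1 = P 2)
    (h10 : P 1 * P 0 = -P 2) (hH : Hᵀ = H) (hK : Kᵀ = K) (hHtr : H.trace = 0) :
    ∑ i, ∑ j, ∑ k, ∑ l, (∑ a, wedge2 (P a * H + H * P a) (P a) i j k l) *
        (∑ b, wedge2 (P b * K + K * P b) (P b) i j k l) =
      -12 * (Fintype.card ι + 8) * (∑ a, (P a * H * P a * K).trace) +
        36 * Fintype.card ι * (H * K).trace := by
  have h02 : P 0 * P 2 = -P 1 := by rw [← h01, ← mul_assoc, hP, neg_one_mul]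
  have h12 : P 1 * P 2 = P 0 := by
    rw [← neg_neg (P 2), ← h10, mul_neg, ← mul_assoc, hP, neg_one_mul, neg_neg]
  have h20 : P 2 * P 0 = P 1 := by
    rw [← neg_neg (P 2), ← h10, neg_mul, mul_assoc, hP, mul_neg_one, neg_neg]
  have h21 : P 2 * P 1 = -P 0 := by rw [← h01, mul_assoc, hP, mul_neg_one]
  have off {a b : Fin 3} (hab : P a * P b = -(P b * P a)) :=
    sum_wedge2_anticomm_of_anticommute (hP a) (hP b) hab (hPt a) (hPt b) hH hK
  have diag (a : Fin 3) := sum_wedge2_anticomm_self (hP a) (hPt a) hH hK hHtr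
  simp only [Fin.sum_univ_three, add_mul, mul_add, Finset.sum_add_distrib] at diag off ⊢
  rw [diag 0, diag 1, diag 2, off (a := 0) (b := 1) (by rw [h01, h10, neg_neg]),
    off (a := 1) (b := 0) (by rw [h01, h10]), off (a := 0) (b := 2) (by rw [h02, h20]),
    off (a := 2) (b := 0) (by rw [h02, h20, neg_neg]),
    off (a := 1) (b := 2) (by rw [h12, h21, neg_neg]),
    off (a := 2) (b := 1) (by rw [h12, h21])]
  simp only [h01, h10, h02, h20, h12, h21, neg_mul, mul_neg, neg_neg]
  ring

end QuaternionicTriples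

section Kraines

variable {V : Type*} [NormedAddCommGroup V] [InnerProductSpace ℝ V]
  {ι : Type*} [Fintype ι] [DecidableEq ι]

lemma inner_apply_eq_neg_of_isometry_of_sq {J : V →ₗ[ℝ] V} (hJ : ∀ x, J (J x) = -x)
    (hJo : ∀ x y : V, ⟪J x, J y⟫ = ⟪x, y⟫) (x y : V) : ⟪J x, y⟫ = -⟪x, J y⟫ := by
  rw [← hJo x (J y), hJ, inner_neg_right, neg_neg]

lemma OrthonormalBasis.toMatrix_apply_eq_inner (e : OrthonormalBasis ι ℝ V) (f : V →ₗ[ℝ] V)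
    (i j : ι) : LinearMap.toMatrix e.toBasis e.toBasis f i j = ⟪e i, f (e j)⟫ := by
  simp [LinearMap.toMatrix_apply, OrthonormalBasis.repr_apply_apply]

/-- The derivative of the Kraines form along a symmetric endomorphism, in an orthonormal basis. -/
lemma iota4_kraines_apply (e : OrthonormalBasis ι ℝ V) (I : Fin 3 → V →ₗ[ℝ] V)
    (hI : ∀ a, ∀ x y : V, ⟪I a x, y⟫ = -⟪x, I a y⟫) {h : V →ₗ[ℝ] V}
    (hh : ∀ x y : V, ⟪h x, y⟫ = ⟪x, h y⟫) (i j k l : ι) :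
    iota4 h (kraines I) (e i) (e j) (e k) (e l) =
      2 * ∑ a, wedge2
        (LinearMap.toMatrix e.toBasis e.toBasis (I a) * LinearMap.toMatrix e.toBasis e.toBasis h +
          LinearMap.toMatrix e.toBasis e.toBasis h * LinearMap.toMatrix e.toBasis e.toBasis (I a))
        (LinearMap.toMatrix e.toBasis e.toBasis (I a)) i j k l := by
  have hF : ∀ a p q,
      (LinearMap.toMatrix e.toBasis e.toBasis (I a) * LinearMap.toMatrix e.toBasis e.toBasis h +
        LinearMap.toMatrix e.toBasis e.toBasis h * LinearMap.toMatrix e.toBasis e.toBasis (I a))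
        p q = -(⟪I a (h (e p)), e q⟫ + ⟪I a (e p), h (e q)⟫) := by
    intro a p q
    rw [← LinearMap.toMatrix_comp, ← LinearMap.toMatrix_comp, Matrix.add_apply,
      e.toMatrix_apply_eq_inner, e.toMatrix_apply_eq_inner, hI, hI, hh]
    simp only [LinearMap.comp_apply]
    ring
  have hω : ∀ a p q, LinearMap.toMatrix e.toBasis e.toBasis (I a) p q = -⟪I a (e p), e q⟫ := by
    intro a p q
    rw [e.toMatrix_apply_eq_inner, hI, neg_neg]
  simp only [iota4, kraines, ← Finset.sum_add_distrib, Finset.mul_sum]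
  refine Finset.sum_congr rfl fun a _ => ?_
  simp only [wedge2, hF, hω]
  ring

end Kraines

/-- Corollary to Lemma A.1: for symmetric traceless endomorphisms `h₁, h₂`,
`⟨ι_{h₁} Ω, ι_{h₂} Ω⟩ = -4(m+4) tr(C(h₁) ∘ h₂) + 12 m tr(h₁ ∘ h₂)` where
`C(h) = Σₐ Iₐ h Iₐ`; the inner product of `4`-forms is `(1/4!) Σ` over an orthonormal
basis. -/
theorem inner_iota_kraines_iota_kraines
    {V : Type*} [NormedAddCommGroup V] [InnerProductSpace ℝ V] [FiniteDimensional ℝ V]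
    {m : ℕ} (e : OrthonormalBasis (Fin (2 * m)) ℝ V)
    (I : Fin 3 → V →ₗ[ℝ] V)
    (hI2 : ∀ a, ∀ x : V, I a (I a x) = -x)
    (hIorth : ∀ a, ∀ x y : V, ⟪I a x, I a y⟫ = ⟪x, y⟫)
    (h12 : ∀ x : V, I 0 (I 1 x) = I 2 x)
    (h21 : ∀ x : V, I 1 (I 0 x) = -(I 2 x))
    (h₁ h₂ : V →ₗ[ℝ] V)
    (hsym₁ : ∀ x y : V, ⟪h₁ x, y⟫ = ⟪x, h₁ y⟫)
    (htr₁ : LinearMap.trace ℝ V h₁ = 0)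
    (hsym₂ : ∀ x y : V, ⟪h₂ x, y⟫ = ⟪x, h₂ y⟫)
    (htr₂ : LinearMap.trace ℝ V h₂ = 0) :
    (1 / 24 : ℝ) * ∑ i, ∑ j, ∑ k, ∑ l,
        iota4 h₁ (kraines I) (e i) (e j) (e k) (e l) *
          iota4 h₂ (kraines I) (e i) (e j) (e k) (e l)
      = -4 * ((m : ℝ) + 4) *
          LinearMap.trace ℝ V ((∑ a : Fin 3, I a ∘ₗ h₁ ∘ₗ I a) ∘ₗ h₂) +
        12 * (m : ℝ) * LinearMap.trace ℝ V (h₁ ∘ₗ h₂) := by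
  have hI := fun a => inner_apply_eq_neg_of_isometry_of_sq (hI2 a) (hIorth a)
  set M := LinearMap.toMatrix e.toBasis e.toBasis with hM
  have hmul : ∀ f g : V →ₗ[ℝ] V, M f * M g = M (f ∘ₗ g) := fun f g =>
    (LinearMap.toMatrix_comp _ e.toBasis _ f g).symm
  have htrace : ∀ f : V →ₗ[ℝ] V, (M f).trace = LinearMap.trace ℝ V f := fun f =>
    (LinearMap.trace_eq_matrix_trace ℝ e.toBasis f).symm
  have hsq : ∀ a, M (I a) * M (I a) = -1 := by
    intro a
    rw [hmul, show I a ∘ₗ I a = -LinearMap.id from LinearMap.ext (hI2 a), map_neg, hM,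
      LinearMap.toMatrix_id]
  have hskew : ∀ a, (M (I a))ᵀ = -M (I a) := by
    intro a
    ext i j
    rw [Matrix.transpose_apply, Matrix.neg_apply, hM, e.toMatrix_apply_eq_inner,
      e.toMatrix_apply_eq_inner, real_inner_comm, hI]
  have hsymm : ∀ {h : V →ₗ[ℝ] V}, (∀ x y : V, ⟪h x, y⟫ = ⟪x, h y⟫) → (M h)ᵀ = M h := by
    intro h hh
    ext i j
    rw [Matrix.transpose_apply, hM, e.toMatrix_apply_eq_inner, e.toMatrix_apply_eq_inner,
      real_inner_comm, hh]
  have h01 : M (I 0) * M (I 1) = M (I 2) := by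
    rw [hmul, show I 0 ∘ₗ I 1 = I 2 from LinearMap.ext h12]
  have h10 : M (I 1) * M (I 0) = -M (I 2) := by
    rw [hmul, show I 1 ∘ₗ I 0 = -I 2 from LinearMap.ext h21, map_neg]
  have key := sum_wedge2_anticomm_mul_sum_wedge2_anticomm hsq hskew h01 h10 (hsymm hsym₁)
    (hsymm hsym₂) ((htrace h₁).trans htr₁)
  have hC : LinearMap.trace ℝ V ((∑ a : Fin 3, I a ∘ₗ h₁ ∘ₗ I a) ∘ₗ h₂) =
      ∑ a, (M (I a) * M h₁ * M (I a) * M h₂).trace := by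
    simp only [hmul, htrace, Fin.sum_univ_three, LinearMap.add_comp, map_add, LinearMap.comp_assoc]
  have hfour : ∀ s t : ℝ, 2 * s * (2 * t) = 4 * (s * t) := fun s t => by ring
  simp only [iota4_kraines_apply e I hI hsym₁, iota4_kraines_apply e I hI hsym₂,
    hfour, ← Finset.mul_sum]
  rw [← hM, key, hC, ← htrace (h₁ ∘ₗ h₂), ← hmul, Fintype.card_fin]
  push_cast
  ring
end

section
/- Let V be a real inner product space of dimension 2m with orthonormal basis (e_k), let I₁, I₂, I₃ be orthogonal complex structures with I₁I₂ = I₃ = −I₂I₁, and let Ω be the Kraines 4-form. Then for all v, w ∈ V: ⟨v⌟Ω, w⌟Ω⟩ = 12(m+1)·⟨v, w⟩. -/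
open scoped RealInnerProductSpace

open Finset

/-- The inner product of the `3`-forms `x ∧ A` and `y ∧ B` in coordinates (up to the factor `3!`),
for covectors `x`, `y` and skew arrays `A`, `B`. -/
lemma sum_wedge_mul_wedge {ι : Type*} [Fintype ι] (x y : ι → ℝ) (A B : ι → ι → ℝ)
    (hA : ∀ i j, A i j = -A j i) (hB : ∀ i j, B i j = -B j i) :
    ∑ i, ∑ j, ∑ k, (x i * A j k - x j * A i k + x k * A i j) *
        (y i * B j k - y j * B i k + y k * B i j) =
      3 * ((∑ i, x i * y i) * ∑ j, ∑ k, A j k * B j k) -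
        6 * ∑ k, (∑ j, y j * A j k) * ∑ i, x i * B i k := by
  set f : ι → ι → ι → ℝ := fun i j k => x i * y i * (A j k * B j k) with hf
  set g : ι → ι → ι → ℝ := fun i j k => x i * y j * A j k * B i k with hg
  have swap₁₂ : ∀ h : ι → ι → ι → ℝ, ∑ i, ∑ j, ∑ k, h j i k = ∑ i, ∑ j, ∑ k, h i j k :=
    fun h => sum_comm
  have swap₂₃ : ∀ h : ι → ι → ι → ℝ, ∑ i, ∑ j, ∑ k, h i k j = ∑ i, ∑ j, ∑ k, h i j k :=
    fun h => sum_congr rfl fun _ _ => sum_comm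
  have cyc : ∀ h : ι → ι → ι → ℝ, ∑ i, ∑ j, ∑ k, h j k i = ∑ i, ∑ j, ∑ k, h i j k :=
    fun h => (swap₁₂ fun i j k => h i k j).trans (swap₂₃ h)
  have cyc' : ∀ h : ι → ι → ι → ℝ, ∑ i, ∑ j, ∑ k, h k i j = ∑ i, ∑ j, ∑ k, h i j k :=
    fun h => (swap₂₃ fun i j k => h j i k).trans (swap₁₂ h)
  have swap₁₃ : ∀ h : ι → ι → ι → ℝ, ∑ i, ∑ j, ∑ k, h k j i = ∑ i, ∑ j, ∑ k, h i j k :=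
    fun h => (swap₁₂ fun i j k => h k i j).trans (cyc' h)
  have expand : ∀ i j k, (x i * A j k - x j * A i k + x k * A i j) *
      (y i * B j k - y j * B i k + y k * B i j) =
      f i j k + f j i k + f k i j -
        (g i j k + g i k j + g j i k + g j k i + g k i j + g k j i) := by
    intro i j k
    simp only [hf, hg]
    rw [hA j i, hA k i, hA k j, hB j i, hB k i, hB k j]
    ring
  have sum_f : ∑ i, ∑ j, ∑ k, f i j k = (∑ i, x i * y i) * ∑ j, ∑ k, A j k * B j k := by
    simp only [hf, sum_mul, ← mul_sum]
  have sum_g : ∑ i, ∑ j, ∑ k, g i j k = ∑ k, (∑ j, y j * A j k) * ∑ i, x i * B i k := by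
    rw [← cyc g]
    refine sum_congr rfl fun k _ => ?_
    rw [sum_mul_sum, sum_comm]
    exact sum_congr rfl fun _ _ => sum_congr rfl fun _ _ => by simp only [hg]; ring
  simp only [expand, sum_add_distrib, sum_sub_distrib]
  rw [swap₁₂ f, cyc' f, swap₂₃ g, swap₁₂ g, cyc g, cyc' g, swap₁₃ g, sum_f, sum_g]
  ring

section SkewOperators

variable {V ι : Type*} [NormedAddCommGroup V] [InnerProductSpace ℝ V] [Fintype ι]

/-- `⟨ξ ∧ α, η ∧ β⟩ = ⟨ξ, η⟩ ⟨α, β⟩ - ⟨η ⌟ α, ξ ⌟ β⟩` (times `3!`), for the `2`-forms `α`, `β`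
of two skew operators `A`, `B`. -/
lemma sum_inner_wedge_mul_inner_wedge (e : OrthonormalBasis ι ℝ V) (A B : V →ₗ[ℝ] V)
    (hA : ∀ x y, ⟪A x, y⟫ = -⟪x, A y⟫) (hB : ∀ x y, ⟪B x, y⟫ = -⟪x, B y⟫) (ξ η : V) :
    ∑ i, ∑ j, ∑ k,
        (⟪ξ, e i⟫ * ⟪A (e j), e k⟫ - ⟪ξ, e j⟫ * ⟪A (e i), e k⟫ + ⟪ξ, e k⟫ * ⟪A (e i), e j⟫) *
        (⟪η, e i⟫ * ⟪B (e j), e k⟫ - ⟪η, e j⟫ * ⟪B (e i), e k⟫ + ⟪η, e k⟫ * ⟪B (e i), e j⟫) =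
      3 * (⟪ξ, η⟫ * ∑ j, ⟪A (e j), B (e j)⟫) - 6 * ⟪A η, B ξ⟫ := by
  have parseval : ∀ x y : V, ∑ i, ⟪x, e i⟫ * ⟪y, e i⟫ = ⟪x, y⟫ := fun x y => by
    rw [← e.sum_inner_mul_inner x y]
    exact sum_congr rfl fun i _ => by rw [real_inner_comm y]
  have contract : ∀ C : V →ₗ[ℝ] V, (∀ x y, ⟪C x, y⟫ = -⟪x, C y⟫) → ∀ (x : V) (k : ι),
      ∑ i, ⟪x, e i⟫ * ⟪C (e i), e k⟫ = ⟪C x, e k⟫ := fun C hC x k => by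
    simp only [hC, mul_neg, sum_neg_distrib, e.sum_inner_mul_inner]
  rw [sum_wedge_mul_wedge (fun i => ⟪ξ, e i⟫) (fun i => ⟪η, e i⟫)
    (fun i j => ⟪A (e i), e j⟫) (fun i j => ⟪B (e i), e j⟫)
    (fun i j => by rw [hA, real_inner_comm]) (fun i j => by rw [hB, real_inner_comm])]
  simp only [contract A hA, contract B hB, parseval]

lemma sum_inner_wedge_self (e : OrthonormalBasis ι ℝ V) (J : V →ₗ[ℝ] V)
    (hJ : ∀ x y, ⟪J x, y⟫ = -⟪x, J y⟫) (hJ2 : ∀ x, J (J x) = -x) (v w : V) :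
    ∑ i, ∑ j, ∑ k,
        (⟪J v, e i⟫ * ⟪J (e j), e k⟫ - ⟪J v, e j⟫ * ⟪J (e i), e k⟫ + ⟪J v, e k⟫ * ⟪J (e i), e j⟫) *
        (⟪J w, e i⟫ * ⟪J (e j), e k⟫ - ⟪J w, e j⟫ * ⟪J (e i), e k⟫ + ⟪J w, e k⟫ * ⟪J (e i), e j⟫) =
      (3 * Fintype.card ι - 6) * ⟪v, w⟫ := by
  rw [sum_inner_wedge_mul_inner_wedge e J J hJ hJ]
  have isometry : ∀ x y, ⟪J x, J y⟫ = ⟪x, y⟫ := fun x y => by simp [hJ, hJ2]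
  simp only [isometry, real_inner_self_eq_norm_sq, e.norm_eq_one, real_inner_comm w v]
  simp
  ring

lemma sum_inner_wedge_of_anticommute (e : OrthonormalBasis ι ℝ V) (J K : V →ₗ[ℝ] V)
    (hJ : ∀ x y, ⟪J x, y⟫ = -⟪x, J y⟫) (hK : ∀ x y, ⟪K x, y⟫ = -⟪x, K y⟫)
    (hJ2 : ∀ x, J (J x) = -x) (hK2 : ∀ x, K (K x) = -x) (hJK : ∀ x, J (K x) = -K (J x))
    (v w : V) :
    ∑ i, ∑ j, ∑ k,
        (⟪J v, e i⟫ * ⟪J (e j), e k⟫ - ⟪J v, e j⟫ * ⟪J (e i), e k⟫ + ⟪J v, e k⟫ * ⟪J (e i), e j⟫) *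
        (⟪K w, e i⟫ * ⟪K (e j), e k⟫ - ⟪K w, e j⟫ * ⟪K (e i), e k⟫ + ⟪K w, e k⟫ * ⟪K (e i), e j⟫) =
      6 * ⟪v, w⟫ := by
  rw [sum_inner_wedge_mul_inner_wedge e J K hJ hK]
  have orthogonal : ∀ x, ⟪J x, K x⟫ = 0 := fun x => by
    have h : ⟪J x, K x⟫ = -⟪K x, J x⟫ := by rw [hJ, hJK, inner_neg_right, hK]
    rw [real_inner_comm (J x)] at h
    linarith
  have cross : ⟪J (K w), K (J v)⟫ = -⟪v, w⟫ := by
    rw [hJK, inner_neg_left, hK, hK2, inner_neg_right, hJ, hJ2, inner_neg_right,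
      real_inner_comm]
    ring
  simp [orthogonal, cross]

end SkewOperators

lemma kraines_eq {V : Type*} [NormedAddCommGroup V] [InnerProductSpace ℝ V]
    (I : Fin 3 → V →ₗ[ℝ] V) (v x y z : V) :
    kraines I v x y z = 2 * ∑ a, (⟪I a v, x⟫ * ⟪I a y, z⟫ - ⟪I a v, y⟫ * ⟪I a x, z⟫ +
      ⟪I a v, z⟫ * ⟪I a x, y⟫) := by
  simp only [kraines, wedge2, mul_sum]
  exact sum_congr rfl fun a _ => by ring

/-- The identity `⟨v ⌟ Ω, w ⌟ Ω⟩ = 12(m+1) ⟨v, w⟩` from the proof of the Corollary to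
Lemma A.1; the inner product of `3`-forms is `(1/3!) Σ` over an orthonormal basis. -/
theorem inner_interior_kraines_interior_kraines
    {V : Type*} [NormedAddCommGroup V] [InnerProductSpace ℝ V] [FiniteDimensional ℝ V]
    {m : ℕ} (e : OrthonormalBasis (Fin (2 * m)) ℝ V)
    (I : Fin 3 → V →ₗ[ℝ] V)
    (hI2 : ∀ a, ∀ x : V, I a (I a x) = -x)
    (hIorth : ∀ a, ∀ x y : V, ⟪I a x, I a y⟫ = ⟪x, y⟫)
    (h12 : ∀ x : V, I 0 (I 1 x) = I 2 x)
    (h21 : ∀ x : V, I 1 (I 0 x) = -(I 2 x)) :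
    ∀ v w : V,
      (1 / 6 : ℝ) * ∑ i, ∑ j, ∑ k,
          kraines I v (e i) (e j) (e k) * kraines I w (e i) (e j) (e k)
        = 12 * ((m : ℝ) + 1) * ⟪v, w⟫ := by
  intro v w
  have skew : ∀ a x y, ⟪I a x, y⟫ = -⟪x, I a y⟫ := fun a x y => by
    rw [← hIorth a x, hI2, inner_neg_right, neg_neg]
  have anti01 : ∀ x, I 0 (I 1 x) = -I 1 (I 0 x) := fun x => by rw [h12, h21, neg_neg]
  have anti02 : ∀ x, I 0 (I 2 x) = -I 2 (I 0 x) := fun x => by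
    rw [← h12, ← h12, anti01 (I 0 x), hI2, hI2, map_neg, neg_neg]
  have anti12 : ∀ x, I 1 (I 2 x) = -I 2 (I 1 x) := fun x => by
    rw [← h12, ← h12, anti01 (I 1 x), neg_neg]
  have anticomm : ∀ a b, a ≠ b → ∀ x, I a (I b x) = -I b (I a x) := by
    intro a b hab x
    fin_cases a <;> fin_cases b <;> simp_all
  set F : Fin 3 → V → Fin (2 * m) → Fin (2 * m) → Fin (2 * m) → ℝ := fun a v i j k =>
    ⟪I a v, e i⟫ * ⟪I a (e j), e k⟫ - ⟪I a v, e j⟫ * ⟪I a (e i), e k⟫ +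
      ⟪I a v, e k⟫ * ⟪I a (e i), e j⟫ with hF
  have pair : ∀ a b, ∑ i, ∑ j, ∑ k, F a v i j k * F b w i j k =
      if a = b then (6 * (m : ℝ) - 6) * ⟪v, w⟫ else 6 * ⟪v, w⟫ := by
    intro a b
    split_ifs with hab
    · subst hab
      rw [sum_inner_wedge_self e (I a) (skew a) (hI2 a), Fintype.card_fin]
      push_cast
      ring
    · exact sum_inner_wedge_of_anticommute e (I a) (I b) (skew a) (skew b) (hI2 a) (hI2 b)
        (anticomm a b hab) v w
  have expand : ∑ i, ∑ j, ∑ k, kraines I v (e i) (e j) (e k) * kraines I w (e i) (e j) (e k) =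
      4 * ∑ a, ∑ b, ∑ i, ∑ j, ∑ k, F a v i j k * F b w i j k := by
    simp only [kraines_eq, Fin.sum_univ_three, ← sum_add_distrib, mul_sum]
    refine sum_congr rfl fun i _ => sum_congr rfl fun j _ => sum_congr rfl fun k _ => ?_
    simp only [hF]
    ring
  rw [expand]
  simp only [pair, Fin.sum_univ_three]
  simp
  ring
end

section
/- Let V be a real inner product space of dimension 2m with orthonormal basis (e_k), let I₁, I₂, I₃ be orthogonal complex structures with I₁I₂ = I₃ = −I₂I₁, and let Ω be the Kraines 4-form. Then the squared norm of Ω is ⟨Ω, Ω⟩ = 6m(m+1). -/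
open scoped RealInnerProductSpace

section SkewMatrix

variable {ι : Type*} [Fintype ι] {A B : Matrix ι ι ℝ}

/-- Contracting `α ∧ α` with an alternating expression in the four indices: each of the six terms
of `α ∧ α` contributes the same amount. -/
lemma sum_wedge2_self_mul (G : ι → ι → ι → ι → ℝ)
    (h₂₃ : ∀ i j k l, G i k j l = -G i j k l) (h₃₄ : ∀ i j k l, G i j l k = -G i j k l) :
    ∑ i, ∑ j, ∑ k, ∑ l, wedge2 A A i j k l * G i j k l
      = 6 * ∑ i, ∑ j, ∑ k, ∑ l, A i j * A k l * G i j k l := by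
  have swap : ∑ i, ∑ j, ∑ k, ∑ l, A i k * A j l * G i j k l
      = -∑ i, ∑ j, ∑ k, ∑ l, A i j * A k l * G i j k l := by
    simp only [← Finset.sum_neg_distrib]
    refine Finset.sum_congr rfl fun i _ => ?_
    rw [Finset.sum_comm]
    refine Finset.sum_congr rfl fun j _ => Finset.sum_congr rfl fun k _ =>
      Finset.sum_congr rfl fun l _ => ?_
    rw [h₂₃ i j k l]
    ring
  have cycle : ∑ i, ∑ j, ∑ k, ∑ l, A i l * A j k * G i j k l
      = -∑ i, ∑ j, ∑ k, ∑ l, A i k * A j l * G i j k l := by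
    simp only [← Finset.sum_neg_distrib]
    refine Finset.sum_congr rfl fun i _ => Finset.sum_congr rfl fun j _ => ?_
    rw [Finset.sum_comm]
    refine Finset.sum_congr rfl fun k _ => Finset.sum_congr rfl fun l _ => ?_
    rw [h₃₄ i j k l]
    ring
  have expand : ∀ i j k l, wedge2 A A i j k l * G i j k l
      = 2 * (A i j * A k l * G i j k l) - 2 * (A i k * A j l * G i j k l)
        + 2 * (A i l * A j k * G i j k l) := by
    intro i j k l
    simp only [wedge2]
    ring
  simp only [expand, Finset.sum_add_distrib, Finset.sum_sub_distrib, ← Finset.mul_sum]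
  rw [cycle, swap]
  ring

lemma sum_mul_eq_neg_trace_mul (hB : ∀ i j, B i j = -B j i) :
    ∑ i, ∑ j, A i j * B i j = -(A * B).trace := by
  simp only [Matrix.trace, Matrix.diag_apply, Matrix.mul_apply, ← Finset.sum_neg_distrib]
  refine Finset.sum_congr rfl fun i _ => Finset.sum_congr rfl fun j _ => ?_
  rw [hB i j]
  ring

lemma sum_cyclic_eq_neg_trace (hB : ∀ i j, B i j = -B j i) :
    ∑ i, ∑ j, ∑ k, ∑ l, A i j * A k l * (B i l * B j k) = -(A * B * A * B).trace := by
  rw [← sum_mul_eq_neg_trace_mul hB]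
  simp only [Matrix.mul_apply, Finset.sum_mul]
  refine Finset.sum_congr rfl fun i _ => ?_
  calc _ = ∑ j, ∑ l, ∑ k, A i j * A k l * (B i l * B j k) :=
        Finset.sum_congr rfl fun j _ => Finset.sum_comm
    _ = ∑ l, ∑ j, ∑ k, A i j * A k l * (B i l * B j k) := Finset.sum_comm
    _ = ∑ l, ∑ k, ∑ j, A i j * A k l * (B i l * B j k) :=
        Finset.sum_congr rfl fun l _ => Finset.sum_comm
    _ = _ := Finset.sum_congr rfl fun l _ => Finset.sum_congr rfl fun k _ =>
        Finset.sum_congr rfl fun j _ => by ring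

/-- The contraction of `α ∧ α` with `β ∧ β` in terms of the matrices of `α` and `β`. -/
lemma sum_wedge2_self_mul_wedge2_self (hA : ∀ i j, A i j = -A j i)
    (hB : ∀ i j, B i j = -B j i) :
    ∑ i, ∑ j, ∑ k, ∑ l, wedge2 A A i j k l * wedge2 B B i j k l
      = 12 * ((A * B).trace ^ 2 - 2 * (A * B * A * B).trace) := by
  rw [sum_wedge2_self_mul]
  · have diagonal : ∑ i, ∑ j, ∑ k, ∑ l, A i j * A k l * (B i j * B k l)
        = (A * B).trace ^ 2 := by
      rw [← neg_sq, ← sum_mul_eq_neg_trace_mul hB, sq]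
      simp only [mul_mul_mul_comm (A _ _) (A _ _), ← Finset.mul_sum, ← Finset.sum_mul]
    have crossed : ∑ i, ∑ j, ∑ k, ∑ l, A i j * A k l * (B i k * B j l)
        = (A * B * A * B).trace := by
      rw [← neg_neg (Matrix.trace _), ← sum_cyclic_eq_neg_trace hB]
      simp only [← Finset.sum_neg_distrib]
      refine Finset.sum_congr rfl fun i _ => Finset.sum_congr rfl fun j _ => ?_
      rw [Finset.sum_comm]
      refine Finset.sum_congr rfl fun k _ => Finset.sum_congr rfl fun l _ => ?_
      rw [hA l k]
      ring
    have expand : ∀ i j k l, A i j * A k l * wedge2 B B i j k l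
        = 2 * (A i j * A k l * (B i j * B k l)) - 2 * (A i j * A k l * (B i k * B j l))
          + 2 * (A i j * A k l * (B i l * B j k)) := by
      intro i j k l
      simp only [wedge2]
      ring
    simp only [expand, Finset.sum_add_distrib, Finset.sum_sub_distrib, ← Finset.mul_sum]
    rw [diagonal, crossed, sum_cyclic_eq_neg_trace hB]
    ring
  · intro i j k l
    simp only [wedge2]
    rw [hB k j]
    ring
  · intro i j k l
    simp only [wedge2]
    rw [hB l k]
    ring

variable [DecidableEq ι]

lemma sum_wedge2_self_mul_self_of_sq_eq_neg_one (hA : ∀ i j, A i j = -A j i)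
    (hA2 : A * A = -1) :
    ∑ i, ∑ j, ∑ k, ∑ l, wedge2 A A i j k l * wedge2 A A i j k l
      = 12 * ((Fintype.card ι : ℝ) ^ 2 - 2 * Fintype.card ι) := by
  rw [sum_wedge2_self_mul_wedge2_self hA hA, Matrix.mul_assoc (A * A), hA2]
  simp

lemma sum_wedge2_self_mul_wedge2_self_of_anticomm (hA : ∀ i j, A i j = -A j i)
    (hB : ∀ i j, B i j = -B j i) (hA2 : A * A = -1) (hB2 : B * B = -1)
    (hAB : A * B = -(B * A)) :
    ∑ i, ∑ j, ∑ k, ∑ l, wedge2 A A i j k l * wedge2 B B i j k l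
      = 24 * Fintype.card ι := by
  have htr : (A * B).trace = 0 := by
    have h := congrArg Matrix.trace hAB
    rw [Matrix.trace_neg, Matrix.trace_mul_comm B A] at h
    linarith
  have hsq : A * B * A * B = -1 := by
    calc A * B * A * B = -(B * (A * A) * B) := by rw [hAB]; noncomm_ring
      _ = -1 := by rw [hA2]; simp [hB2]
  rw [sum_wedge2_self_mul_wedge2_self hA hB, htr, hsq]
  simp only [Matrix.trace_neg, Matrix.trace_one]
  ring

end SkewMatrix

section ComplexStructure

variable {V : Type*} [NormedAddCommGroup V] [InnerProductSpace ℝ V]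

lemma inner_map_eq_neg_inner_map {J : V →ₗ[ℝ] V} (hJ2 : ∀ x, J (J x) = -x)
    (hJ : ∀ x y, ⟪J x, J y⟫ = ⟪x, y⟫) (x y : V) : ⟪J x, y⟫ = -⟪x, J y⟫ := by
  rw [← hJ x, hJ2, inner_neg_right, neg_neg]

/-- The matrix of the bilinear form `⟪J x, y⟫` in an orthonormal basis. -/
noncomputable def formMatrix {ι : Type*} [Fintype ι] (e : OrthonormalBasis ι ℝ V) (J : V →ₗ[ℝ] V) :
    Matrix ι ι ℝ :=
  fun i j => ⟪J (e i), e j⟫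

variable {ι : Type*} [Fintype ι] (e : OrthonormalBasis ι ℝ V)

lemma formMatrix_mul_formMatrix (J K : V →ₗ[ℝ] V) :
    formMatrix e J * formMatrix e K = formMatrix e (K ∘ₗ J) := by
  ext i k
  simp only [Matrix.mul_apply, formMatrix, LinearMap.comp_apply]
  conv_rhs => rw [← e.sum_repr' (J (e i)), map_sum, sum_inner]
  refine Finset.sum_congr rfl fun j _ => ?_
  rw [map_smul, real_inner_smul_left, real_inner_comm]

lemma formMatrix_skew {J : V →ₗ[ℝ] V} (hJ2 : ∀ x, J (J x) = -x)
    (hJ : ∀ x y, ⟪J x, J y⟫ = ⟪x, y⟫) (i j : ι) :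
    formMatrix e J i j = -formMatrix e J j i := by
  simp only [formMatrix]
  rw [inner_map_eq_neg_inner_map hJ2 hJ, real_inner_comm]

lemma formMatrix_mul_self [DecidableEq ι] {J : V →ₗ[ℝ] V} (hJ2 : ∀ x, J (J x) = -x) :
    formMatrix e J * formMatrix e J = -1 := by
  rw [formMatrix_mul_formMatrix]
  ext i j
  simp [formMatrix, hJ2, Matrix.one_apply, e.inner_eq_ite]

lemma formMatrix_anticomm {J K : V →ₗ[ℝ] V} (h : ∀ x, J (K x) = -K (J x)) :
    formMatrix e J * formMatrix e K = -(formMatrix e K * formMatrix e J) := by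
  simp only [formMatrix_mul_formMatrix]
  ext i j
  simp [formMatrix, h]

end ComplexStructure

/-- The identity `⟨Ω, Ω⟩ = 6m(m+1)` from the proof of the Corollary to Lemma A.1; the
inner product of `4`-forms is `(1/4!) Σ` over an orthonormal basis. -/
theorem norm_sq_kraines
    {V : Type*} [NormedAddCommGroup V] [InnerProductSpace ℝ V] [FiniteDimensional ℝ V]
    {m : ℕ} (e : OrthonormalBasis (Fin (2 * m)) ℝ V)
    (I : Fin 3 → V →ₗ[ℝ] V)
    (hI2 : ∀ a, ∀ x : V, I a (I a x) = -x)
    (hIorth : ∀ a, ∀ x y : V, ⟪I a x, I a y⟫ = ⟪x, y⟫)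
    (h12 : ∀ x : V, I 0 (I 1 x) = I 2 x)
    (h21 : ∀ x : V, I 1 (I 0 x) = -(I 2 x)) :
    (1 / 24 : ℝ) * ∑ i, ∑ j, ∑ k, ∑ l,
        kraines I (e i) (e j) (e k) (e l) * kraines I (e i) (e j) (e k) (e l)
      = 6 * (m : ℝ) * ((m : ℝ) + 1) := by
  have hskew a := formMatrix_skew e (hI2 a) (hIorth a)
  have hsq a := formMatrix_mul_self e (hI2 a)
  have h01 : ∀ x, I 0 (I 1 x) = -I 1 (I 0 x) := fun x => by rw [h12, h21, neg_neg]
  have h02 : ∀ x, I 0 (I 2 x) = -I 2 (I 0 x) := fun x => by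
    rw [← h12 x, ← h12 (I 0 x), hI2, h01 (I 0 x), hI2, map_neg]
    simp
  have h12' : ∀ x, I 1 (I 2 x) = -I 2 (I 1 x) := fun x => by
    rw [← h12 x, ← h12 (I 1 x), hI2, map_neg, neg_neg, ← neg_eq_iff_eq_neg.mpr (h01 (I 1 x)), hI2]
    simp
  have hself a := sum_wedge2_self_mul_self_of_sq_eq_neg_one (hskew a) (hsq a)
  have hpair a b (h : ∀ x, I a (I b x) = -I b (I a x)) :=
    sum_wedge2_self_mul_wedge2_self_of_anticomm (hskew a) (hskew b) (hsq a) (hsq b)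
      (formMatrix_anticomm e h)
  set W : Fin 3 → Fin (2 * m) → Fin (2 * m) → Fin (2 * m) → Fin (2 * m) → ℝ :=
    fun a => wedge2 (formMatrix e (I a)) (formMatrix e (I a)) with hW
  have expand : ∀ i j k l,
      kraines I (e i) (e j) (e k) (e l) * kraines I (e i) (e j) (e k) (e l)
        = W 0 i j k l * W 0 i j k l + W 1 i j k l * W 1 i j k l + W 2 i j k l * W 2 i j k l
          + 2 * (W 0 i j k l * W 1 i j k l) + 2 * (W 0 i j k l * W 2 i j k l)
          + 2 * (W 1 i j k l * W 2 i j k l) := by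
    intro i j k l
    have hK : kraines I (e i) (e j) (e k) (e l) = W 0 i j k l + W 1 i j k l + W 2 i j k l :=
      Fin.sum_univ_three _
    rw [hK]
    ring
  simp only [expand, Finset.sum_add_distrib, ← Finset.mul_sum]
  simp only [hW, hself, hpair 0 1 h01, hpair 0 2 h02, hpair 1 2 h12', Fintype.card_fin]
  push_cast
  ring
end
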